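/- (Lemma 2, approximate trajectory bound.) Let Ā be a real n_s × n_s matrix, C an n × n_s real matrix, s₀ ∈ ℝ^{n_s}, and suppose U is a symmetric positive definite matrix and δ ≥ 0 a real number satisfying the SDP constraints: Āᵀ U + U Ā ⪯ 0, s₀ᵀ U s₀ ≤ 1, and the block matrix [[U, Cᵀ], [C, δI]] ⪰ 0. Let s : ℝ → ℝ^{n_s} be differentiable with s'(t) = Ā s(t) for all t and s(t₀) = s₀. Then ‖C s(t)‖² ≤ δ for all t ≥ t₀. -/

import Mathlib

open Matrix

/-- Lemma 2, approximate trajectory bound: if `U ≻ 0` and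
`δ ≥ 0` satisfy the SDP constraints `Āᵀ U + U Ā ⪯ 0`, `s₀ᵀ U s₀ ≤ 1`, and
`[[U, Cᵀ], [C, δI]] ⪰ 0`, then any solution of `ṡ = Ā s` starting at `s₀`
satisfies `‖C s(t)‖² ≤ δ` for all `t ≥ t₀`. -/
theorem sdp_trajectory_bound {ns n : ℕ}
    (Abar U : Matrix (Fin ns) (Fin ns) ℝ) (C : Matrix (Fin n) (Fin ns) ℝ)
    (s₀ : Fin ns → ℝ) (δ : ℝ) (hδ : 0 ≤ δ)
    (hUsymm : Uᵀ = U) (hUpd : ∀ q : Fin ns → ℝ, q ≠ 0 → 0 < q ⬝ᵥ U *ᵥ q)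
    (hLyap : ∀ q : Fin ns → ℝ, q ⬝ᵥ (Abarᵀ * U + U * Abar) *ᵥ q ≤ 0)
    (hs₀ : s₀ ⬝ᵥ U *ᵥ s₀ ≤ 1)
    (hblock : (Matrix.fromBlocks U Cᵀ C (δ • (1 : Matrix (Fin n) (Fin n) ℝ))).PosSemidef)
    (t₀ : ℝ) (s : ℝ → (Fin ns → ℝ))
    (hs : ∀ t : ℝ, HasDerivAt s (Abar *ᵥ s t) t) (hinit : s t₀ = s₀) :
    ∀ t : ℝ, t₀ ≤ t → (C *ᵥ s t) ⬝ᵥ (C *ᵥ s t) ≤ δ := by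
  have hV : ∀ t, HasDerivAt (fun t => s t ⬝ᵥ U *ᵥ s t)
      (s t ⬝ᵥ (Abarᵀ * U + U * Abar) *ᵥ s t) t := by
    intro t
    have h1 : ∀ i, HasDerivAt (fun t => s t i) ((Abar *ᵥ s t) i) t :=
      hasDerivAt_pi.1 (hs t)
    have h2 : ∀ i, HasDerivAt (fun t => (U *ᵥ s t) i) ((U *ᵥ (Abar *ᵥ s t)) i) t := by
      intro i
      simp only [Matrix.mulVec, dotProduct]
      exact HasDerivAt.fun_sum fun j _ => (h1 j).const_mul (U i j)
    have h3 : HasDerivAt (fun t => s t ⬝ᵥ U *ᵥ s t)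
        (∑ i, ((Abar *ᵥ s t) i * (U *ᵥ s t) i + s t i * (U *ᵥ (Abar *ᵥ s t)) i)) t := by
      exact HasDerivAt.fun_sum fun j _ => (h1 j).mul (h2 j)
    convert h3 using 1
    rw [Finset.sum_add_distrib, Matrix.add_mulVec, dotProduct_add, ← Matrix.mulVec_mulVec,
      ← Matrix.mulVec_mulVec, Matrix.dotProduct_mulVec _ Abarᵀ, Matrix.vecMul_transpose]
    rfl
  have hanti : Antitone (fun t => s t ⬝ᵥ U *ᵥ s t) :=
    antitone_of_deriv_nonpos (fun t => (hV t).differentiableAt)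
      (fun t => by rw [(hV t).deriv]; exact hLyap _)
  intro t ht
  have hV1 : s t ⬝ᵥ U *ᵥ s t ≤ 1 := by
    have := hanti ht
    simp only [hinit] at this
    linarith
  have key : ∀ a b : ℝ, 0 ≤ a ^ 2 * (s t ⬝ᵥ U *ᵥ s t)
      + 2 * a * b * ((C *ᵥ s t) ⬝ᵥ (C *ᵥ s t)) + δ * b ^ 2 * ((C *ᵥ s t) ⬝ᵥ (C *ᵥ s t)) := by
    intro a b
    have h := hblock.dotProduct_mulVec_nonneg (Sum.elim (a • s t) (b • (C *ᵥ s t)))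
    have hc : s t ⬝ᵥ (Cᵀ *ᵥ (C *ᵥ s t)) = (C *ᵥ s t) ⬝ᵥ (C *ᵥ s t) := by
      rw [Matrix.dotProduct_mulVec, Matrix.vecMul_transpose]
    rw [Matrix.fromBlocks_mulVec, star_trivial, Sum.elim_comp_inl, Sum.elim_comp_inr,
      sumElim_dotProduct_sumElim] at h
    simp only [Matrix.mulVec_smul, Matrix.smul_mulVec, Matrix.one_mulVec, dotProduct_add,
      dotProduct_smul, smul_dotProduct, smul_eq_mul, hc] at h
    linarith
  generalize (C *ᵥ s t) ⬝ᵥ (C *ᵥ s t) = Y at *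
  generalize s t ⬝ᵥ U *ᵥ s t = V at *
  by_contra! hlt
  rcases hδ.eq_or_lt with h0 | h0
  · subst h0
    have := key 1 (-(1 / Y))
    have e : 1 / Y * Y = 1 := by field_simp
    nlinarith
  · have := key δ (-1)
    have h2 : 0 ≤ δ * (δ * V - Y) := by nlinarith
    have h3 := nonneg_of_mul_nonneg_right h2 h0
    nlinarith
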